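/- Let R be a d-class association scheme. If there is at most one index i ∈ {1,…,d} such that the relation A_i is neither strongly regular of Latin square type nor strongly regular of negative Latin square type, then R is amorphic. -/

import Mathlib

open Matrix

section Defs

variable {X ι : Type*}

/-- The all-ones matrix `J`. -/
def allOnes (X : Type*) : Matrix X X ℝ := Matrix.of fun _ _ => 1

/-- A family of symmetric 01-matrices indexed by `ι` forming a (symmetric) association
scheme, with the identity relation at index `o`. -/
def IsASFamily [Fintype X] [DecidableEq X] [Fintype ι] (A : ι → Matrix X X ℝ) (o : ι) :
    Prop :=
  A o = 1 ∧
  ∑ i, A i = allOnes X ∧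
  (∀ i, (A i).IsSymm) ∧
  (∀ i x y, A i x y = 0 ∨ A i x y = 1) ∧
  ∀ i j, ∃ p : ι → ℝ, A i * A j = ∑ h, p h • A h

/-- A `d`-class association scheme, given by its relations `A 0, …, A d`. -/
abbrev IsAssociationScheme [Fintype X] [DecidableEq X] {d : ℕ}
    (A : Fin (d + 1) → Matrix X X ℝ) : Prop :=
  IsASFamily A 0

/-- The family of fused relations along the class map `f`. -/
def fusedFamily {d d' : ℕ} (A : Fin (d + 1) → Matrix X X ℝ)
    (f : Fin (d + 1) → Fin (d' + 1)) : Fin (d' + 1) → Matrix X X ℝ :=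
  fun i => ∑ k ∈ Finset.univ.filter (fun k => f k = i), A k

/-- `f` encodes a partition of `{0, …, d}` having `{0}` as a class (classes = fibers). -/
def IsFusionMap {d d' : ℕ} (f : Fin (d + 1) → Fin (d' + 1)) : Prop :=
  Function.Surjective f ∧ ∀ k, f k = 0 ↔ k = 0

/-- An association scheme is amorphic if every partition of the index set with `{0}` as a
class gives rise to a fusion scheme. -/
def IsAmorphic [Fintype X] [DecidableEq X] {d : ℕ} (A : Fin (d + 1) → Matrix X X ℝ) :
    Prop :=
  ∀ (d' : ℕ) (f : Fin (d + 1) → Fin (d' + 1)), IsFusionMap f →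
    IsAssociationScheme (fusedFamily A f)

/-- `f` encodes the partition of `{0, …, d}` whose unique non-singleton class is `{i, j}`. -/
def PairPartition {d : ℕ} (f : Fin (d + 1) → Fin (d - 1 + 1)) (i j : Fin (d + 1)) : Prop :=
  IsFusionMap f ∧ ∀ k l, f k = f l ↔ (k = l ∨ (k = i ∧ l = j) ∨ (k = j ∧ l = i))

/-- The pair of non-trivial relations `{A i, A j}` fuses. -/
def PairFuses [Fintype X] [DecidableEq X] {d : ℕ} (A : Fin (d + 1) → Matrix X X ℝ)
    (i j : Fin (d + 1)) : Prop :=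
  i ≠ 0 ∧ j ≠ 0 ∧ i ≠ j ∧
  ∃ f : Fin (d + 1) → Fin (d - 1 + 1), PairPartition f i j ∧
    IsAssociationScheme (fusedFamily A f)

/-- The fusing-relations graph, on the vertex set `{1, …, d}`. -/
def fusingRelationsGraph [Fintype X] [DecidableEq X] {d : ℕ}
    (A : Fin (d + 1) → Matrix X X ℝ) : SimpleGraph {i : Fin (d + 1) // i ≠ 0} :=
  SimpleGraph.fromRel fun i j => PairFuses A i.1 j.1

/-- `E 0, …, E d` is the family of minimal idempotents of the scheme `A 0, …, A d`. -/
def IsMinimalIdempotentFamily [Fintype X] [DecidableEq X] {d : ℕ}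
    (A E : Fin (d + 1) → Matrix X X ℝ) : Prop :=
  E 0 = (Fintype.card X : ℝ)⁻¹ • allOnes X ∧
  ∑ j, E j = 1 ∧
  (∀ i j, E i * E j = if i = j then E i else 0) ∧
  (∀ j, (E j).IsSymm) ∧
  ∀ j, ∃ c : Fin (d + 1) → ℝ, E j = ∑ i, c i • A i

/-- The pair of non-trivial minimal idempotents `{E i, E j}` fuses: some fusion scheme of
the scheme has `{E k : k ∉ {i,j}} ∪ {E i + E j}` as its set of minimal idempotents. -/
def IdemPairFuses [Fintype X] [DecidableEq X] {d : ℕ} (A E : Fin (d + 1) → Matrix X X ℝ)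
    (i j : Fin (d + 1)) : Prop :=
  i ≠ 0 ∧ j ≠ 0 ∧ i ≠ j ∧
  ∃ (d' : ℕ) (f : Fin (d + 1) → Fin (d' + 1)), IsFusionMap f ∧
    IsAssociationScheme (fusedFamily A f) ∧
    ∃ E' : Fin (d' + 1) → Matrix X X ℝ,
      IsMinimalIdempotentFamily (fusedFamily A f) E' ∧
      Set.range E' = (E '' {k | k ≠ i ∧ k ≠ j}) ∪ {E i + E j}

/-- The fusing-idempotents graph, on the vertex set `{1, …, d}`. -/
def fusingIdempotentsGraph [Fintype X] [DecidableEq X] {d : ℕ}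
    (A E : Fin (d + 1) → Matrix X X ℝ) : SimpleGraph {i : Fin (d + 1) // i ≠ 0} :=
  SimpleGraph.fromRel fun i j => IdemPairFuses A E i.1 j.1

/-- `A` is the adjacency matrix of a strongly regular graph with parameters `(v,k,l,m)`:
a symmetric 01-matrix with zero diagonal, non-empty, non-complete, with
`A² = k I + l A + m (J - I - A)`. -/
def IsSRGMatrix [Fintype X] [DecidableEq X] (A : Matrix X X ℝ) (v k l m : ℕ) : Prop :=
  Fintype.card X = v ∧
  A.IsSymm ∧ (∀ x, A x x = 0) ∧ (∀ x y, A x y = 0 ∨ A x y = 1) ∧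
  A ≠ 0 ∧ A ≠ allOnes X - 1 ∧
  A * A = (k : ℝ) • (1 : Matrix X X ℝ) + (l : ℝ) • A + (m : ℝ) • (allOnes X - 1 - A)

/-- `x` is a restricted eigenvalue of a strongly regular graph with parameters `(v,k,l,m)`,
i.e. a root of `x² - (l - m) x - (k - m)`. -/
def IsRestrictedEig (k l m : ℕ) (x : ℝ) : Prop :=
  x ^ 2 - ((l : ℝ) - (m : ℝ)) * x - ((k : ℝ) - (m : ℝ)) = 0

/-- Strongly regular parameters of Latin square type: `v = n²`, `k = t (n-1)` and the
restricted eigenvalues are `n - t` and `-t`, for positive integers `n`, `t`. -/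
def IsLSParams (v k l m : ℕ) : Prop :=
  ∃ n t : ℤ, 0 < n ∧ 0 < t ∧ (v : ℤ) = n ^ 2 ∧ (k : ℤ) = t * (n - 1) ∧
    IsRestrictedEig k l m ((n : ℝ) - (t : ℝ)) ∧ IsRestrictedEig k l m (-(t : ℝ))

/-- Strongly regular parameters of negative Latin square type. -/
def IsNLSParams (v k l m : ℕ) : Prop :=
  ∃ n t : ℤ, n < 0 ∧ t < 0 ∧ (v : ℤ) = n ^ 2 ∧ (k : ℤ) = t * (n - 1) ∧
    IsRestrictedEig k l m ((n : ℝ) - (t : ℝ)) ∧ IsRestrictedEig k l m (-(t : ℝ))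

/-- `A` is the adjacency matrix of a strongly regular graph of Latin square type. -/
def IsLSTypeSRG [Fintype X] [DecidableEq X] (A : Matrix X X ℝ) : Prop :=
  ∃ v k l m : ℕ, IsSRGMatrix A v k l m ∧ IsLSParams v k l m

/-- `A` is the adjacency matrix of a strongly regular graph of negative Latin square type. -/
def IsNLSTypeSRG [Fintype X] [DecidableEq X] (A : Matrix X X ℝ) : Prop :=
  ∃ v k l m : ℕ, IsSRGMatrix A v k l m ∧ IsNLSParams v k l m

/-- Strongly regular parameters of a conference graph: `k = (v-1)/2` and restricted
eigenvalues `(-1 ± √v)/2`. -/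
def IsConferenceParams (v k l m : ℕ) : Prop :=
  2 * k + 1 = v ∧ IsRestrictedEig k l m ((-1 + Real.sqrt v) / 2) ∧
    IsRestrictedEig k l m ((-1 - Real.sqrt v) / 2)

/-- The `j`-th idempotent (read off from the second eigenmatrix `Q` of a scheme on `v`
points) is strongly regular of Latin square type: `v = n²`, its rank `Q 0 j` equals
`t (n-1)`, and its restricted dual eigenvalues are exactly `n - t` and `-t`. -/
def IdemLSType {d : ℕ} (v : ℕ) (Q : Matrix (Fin (d + 1)) (Fin (d + 1)) ℝ)
    (j : Fin (d + 1)) : Prop :=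
  ∃ n t : ℤ, 0 < n ∧ 0 < t ∧ (v : ℤ) = n ^ 2 ∧ Q 0 j = ((t * (n - 1) : ℤ) : ℝ) ∧
    {x : ℝ | ∃ i : Fin (d + 1), i ≠ 0 ∧ Q i j = x} = {(n : ℝ) - (t : ℝ), -(t : ℝ)}

/-- Strongly regular idempotent of negative Latin square type. -/
def IdemNLSType {d : ℕ} (v : ℕ) (Q : Matrix (Fin (d + 1)) (Fin (d + 1)) ℝ)
    (j : Fin (d + 1)) : Prop :=
  ∃ n t : ℤ, n < 0 ∧ t < 0 ∧ (v : ℤ) = n ^ 2 ∧ Q 0 j = ((t * (n - 1) : ℤ) : ℝ) ∧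
    {x : ℝ | ∃ i : Fin (d + 1), i ≠ 0 ∧ Q i j = x} = {(n : ℝ) - (t : ℝ), -(t : ℝ)}

/-- The linear functional `x ↦ ∑ u, x u`. -/
noncomputable def sumLin (X : Type*) [Fintype X] : (X → ℝ) →ₗ[ℝ] ℝ where
  toFun x := ∑ u, x u
  map_add' x y := by simp [Finset.sum_add_distrib]
  map_smul' c x := by simp [Finset.mul_sum]

/-- The common restricted eigenspace `{x : ∑ x = 0, A₁ x = θ x, A₂ x = η x}`. -/
noncomputable def restrictedEigenspace [Fintype X] (A1 A2 : Matrix X X ℝ) (θ η : ℝ) :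
    Submodule ℝ (X → ℝ) :=
  LinearMap.ker (sumLin X) ⊓
    LinearMap.ker (A1.mulVecLin - θ • (LinearMap.id : (X → ℝ) →ₗ[ℝ] X → ℝ)) ⊓
    LinearMap.ker (A2.mulVecLin - η • (LinearMap.id : (X → ℝ) →ₗ[ℝ] X → ℝ))

/-- Fusing the relations `A i` and `A j` produces a scheme whose set of minimal
idempotents is `{E k : k ∉ {i', j'}} ∪ {E i' + E j'}`. -/
def FusionIdemSetEq [Fintype X] [DecidableEq X] {d : ℕ} (A E : Fin (d + 1) → Matrix X X ℝ)
    (i j i' j' : Fin (d + 1)) : Prop :=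
  ∀ f : Fin (d + 1) → Fin (d - 1 + 1), PairPartition f i j →
    ∀ E' : Fin (d - 1 + 1) → Matrix X X ℝ,
      IsMinimalIdempotentFamily (fusedFamily A f) E' →
      Set.range E' = (E '' {k | k ≠ i' ∧ k ≠ j'}) ∪ {E i' + E j'}

end Defs

section Proof

set_option linter.unusedSectionVars false

variable {X : Type*} [Fintype X] [DecidableEq X]

lemma allOnes_apply (x y : X) : allOnes X x y = 1 := rfl

lemma allOnes_mul_self : allOnes X * allOnes X = (Fintype.card X : ℝ) • allOnes X := by
  ext x y
  simp [Matrix.mul_apply, allOnes_apply]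

lemma trace_allOnes : (allOnes X).trace = (Fintype.card X : ℝ) := by
  simp [Matrix.trace, allOnes_apply]

lemma allOnes_transpose : (allOnes X)ᵀ = allOnes X := by
  ext x y; simp [allOnes_apply]

/-- Common algebraic package for Latin square (`n > 0`) and negative Latin square (`n < 0`)
type graphs. -/
structure LatinLike (A : Matrix X X ℝ) (n t : ℝ) : Prop where
  card : (Fintype.card X : ℝ) = n ^ 2
  pos : 0 < t * n
  kpos : 0 < t * (n - 1)
  symm : Aᵀ = A
  tr : A.trace = 0
  row : A * allOnes X = (t * (n - 1)) • allOnes X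
  sq : A * A = (n - 2 * t) • A + (t * (n - t)) • (1 : Matrix X X ℝ) + (t ^ 2 - t) • allOnes X

lemma LatinLike.hn {A : Matrix X X ℝ} {n t : ℝ} (h : LatinLike A n t) : n ≠ 0 := by
  rintro rfl; simpa using h.pos

lemma LatinLike.ht {A : Matrix X X ℝ} {n t : ℝ} (h : LatinLike A n t) : t ≠ 0 := by
  rintro rfl; simpa using h.pos

lemma LatinLike.row' {A : Matrix X X ℝ} {n t : ℝ} (h : LatinLike A n t) :
    allOnes X * A = (t * (n - 1)) • allOnes X := by
  have := congrArg Matrix.transpose h.row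
  simpa [Matrix.transpose_mul, h.symm, allOnes_transpose] using this

/-- Conference graphs are of both types. -/
lemma LatinLike.switch {A : Matrix X X ℝ} {n t : ℝ} (h : LatinLike A n t)
    (hnt : n = 2 * t - 1) : LatinLike A (-n) (1 - t) := by
  have h1 := h.pos
  have h2 := h.kpos
  subst hnt
  refine ⟨by rw [h.card]; ring, ?_, ?_, h.symm, h.tr, ?_, ?_⟩
  · rcases lt_or_ge t 0 with ht | ht
    · nlinarith
    · have : 0 < 2 * t - 1 - 1 := by
        by_contra hc
        push Not at hc
        nlinarith
      nlinarith
  · nlinarith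
  · rw [h.row]; congr 1; ring
  · rw [h.sq]; congr 1
    · congr 1
      · congr 1; ring
      · congr 1; ring
    · congr 1; ring

lemma latinLike_of_srg {A : Matrix X X ℝ} {v k l m : ℕ} (h : IsSRGMatrix A v k l m)
    {n t : ℤ} (hpos : 0 < t * n) (hv : (v : ℤ) = n ^ 2) (hk : (k : ℤ) = t * (n - 1))
    (e1 : IsRestrictedEig k l m ((n : ℝ) - (t : ℝ))) (e2 : IsRestrictedEig k l m (-(t : ℝ))) :
    LatinLike A n t := by
  obtain ⟨hc, hs, hd, h01, hne, -, hsq⟩ := h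
  have hn0 : (n : ℝ) ≠ 0 := by
    intro h0
    have : n = 0 := by exact_mod_cast h0
    simp [this] at hpos
  have hkR : (k : ℝ) = t * (n - 1) := by exact_mod_cast hk
  have hrow : ∀ x, ∑ y, A x y = k := by
    intro x
    have := congrFun (congrFun hsq x) x
    simp only [Matrix.mul_apply, Matrix.add_apply, Matrix.smul_apply, Matrix.sub_apply,
      allOnes_apply, Matrix.one_apply_eq, hd] at this
    have h2 : ∑ y, A x y = ∑ y, A x y * A y x := by
      refine Finset.sum_congr rfl fun y _ => ?_
      rw [hs.apply x y]
      rcases h01 x y with h | h <;> simp [h]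
    rw [h2, this]; simp
  unfold IsRestrictedEig at e1 e2
  have hlm : (l : ℝ) - m = n - 2 * t := by
    have : (n : ℝ) * ((l : ℝ) - m - (n - 2 * t)) = 0 := by linear_combination e2 - e1
    rcases mul_eq_zero.1 this with h | h
    · exact absurd h hn0
    · linarith
  have hm : (m : ℝ) = t ^ 2 - t := by
    rw [hlm] at e2
    rw [hkR] at e2
    linear_combination e2
  have hl : (l : ℝ) = n - 2 * t + (t ^ 2 - t) := by rw [← hm]; linarith
  refine ⟨?_, by exact_mod_cast hpos, ?_, hs, ?_, ?_, ?_⟩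
  · rw [hc]; exact_mod_cast hv
  · rw [← hkR]
    have : k ≠ 0 := by
      rintro rfl
      apply hne
      ext x y
      have hx := hrow x
      rw [Nat.cast_zero, Finset.sum_eq_zero_iff_of_nonneg] at hx
      · exact hx y (Finset.mem_univ y)
      · intro z _
        rcases h01 x z with h | h <;> simp [h]
    exact_mod_cast Nat.pos_of_ne_zero this
  · simp [Matrix.trace, hd]
  · ext x y
    simp [Matrix.mul_apply, allOnes_apply, hrow, hkR]
  · rw [hsq, hl, hm, hkR]
    module

/-- `n` times the projection. -/
noncomputable def projM (A : Matrix X X ℝ) (n t : ℝ) : Matrix X X ℝ :=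
  n⁻¹ • A + (t / n) • (1 : Matrix X X ℝ) - (t / n ^ 2) • allOnes X

section
variable {A B : Matrix X X ℝ} {n t n' t' : ℝ}

lemma projM_inv (h : LatinLike A n t) :
    A = n • projM A n t - t • (1 : Matrix X X ℝ) + (t / n) • allOnes X := by
  have hn := h.hn
  unfold projM
  match_scalars <;> field_simp <;> ring

lemma projM_mul_J (h : LatinLike A n t) : projM A n t * allOnes X = 0 := by
  have hn := h.hn
  unfold projM
  simp only [sub_mul, add_mul, smul_mul_assoc, h.row, allOnes_mul_self, h.card, one_mul]
  match_scalars
  field_simp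
  ring

lemma J_mul_projM (h : LatinLike A n t) : allOnes X * projM A n t = 0 := by
  have hn := h.hn
  unfold projM
  simp only [mul_sub, mul_add, mul_smul_comm, h.row', allOnes_mul_self, h.card, mul_one]
  match_scalars
  field_simp
  ring

lemma projM_symm (h : LatinLike A n t) : (projM A n t)ᵀ = projM A n t := by
  simp [projM, h.symm, allOnes_transpose]

lemma projM_idem (h : LatinLike A n t) : projM A n t * projM A n t = projM A n t := by
  have hn := h.hn
  unfold projM
  simp only [mul_sub, mul_add, sub_mul, add_mul, smul_mul_assoc, mul_smul_comm, h.row, h.row',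
    h.sq, allOnes_mul_self, h.card, one_mul, mul_one]
  match_scalars <;> field_simp <;> ring

lemma projM_trace (h : LatinLike A n t) : (projM A n t).trace = t * (n - 1) := by
  have hn := h.hn
  simp only [projM, Matrix.trace_sub, Matrix.trace_add, Matrix.trace_smul, h.tr,
    Matrix.trace_one, trace_allOnes, h.card, smul_eq_mul]
  field_simp
  ring

lemma projM_trace_mul (h : LatinLike A n t) (h' : LatinLike B n' t')
    (hAB : (A * B).trace = 0) :
    (projM A n t * projM B n' t').trace = t * t' * (n / n' - 1) := by
  have hn := h.hn
  have hn' := h'.hn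
  have key : projM A n t * projM B n' t' =
      n'⁻¹ • (projM A n t * B) + (t' / n') • projM A n t := by
    conv_lhs => rw [projM.eq_def B n' t', mul_sub, mul_smul_comm (t' / n' ^ 2), projM_mul_J h]
    simp [mul_add]
  have h2 : (projM A n t * B).trace = - (t * t' * (n' - 1)) := by
    rw [projM, sub_mul, add_mul, smul_mul_assoc, smul_mul_assoc, smul_mul_assoc, one_mul,
      h'.row']
    simp only [Matrix.trace_sub, Matrix.trace_add, Matrix.trace_smul, hAB, h'.tr,
      trace_allOnes, h.card, smul_eq_mul]
    field_simp
    ring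
  rw [key, Matrix.trace_add, Matrix.trace_smul, Matrix.trace_smul, h2, projM_trace h,
    smul_eq_mul, smul_eq_mul]
  field_simp
  ring

/-- Symmetric commuting idempotents with trace-zero product are orthogonal. -/
lemma mul_eq_zero_of_trace {P Q : Matrix X X ℝ} (hP : Pᵀ = P) (hQ : Qᵀ = Q)
    (hPP : P * P = P) (hQQ : Q * Q = Q) (hc : P * Q = Q * P) (ht : (P * Q).trace = 0) :
    P * Q = 0 := by
  rw [← Matrix.trace_conjTranspose_mul_self_eq_zero_iff]
  rw [Matrix.conjTranspose_eq_transpose_of_trivial, Matrix.transpose_mul, hP, hQ]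
  have : Q * P * (P * Q) = P * Q := by
    rw [mul_assoc, ← mul_assoc P P Q, hPP, hc, ← mul_assoc, hQQ]
  rw [this, ht]

end

section Scheme

variable {d : ℕ} {A : Fin (d + 1) → Matrix X X ℝ}

lemma scheme_nonneg (hA : IsAssociationScheme A) (i : Fin (d + 1)) (x y : X) : 0 ≤ A i x y := by
  rcases hA.2.2.2.1 i x y with h | h <;> simp [h]

lemma scheme_sum (hA : IsAssociationScheme A) (x y : X) : ∑ i, A i x y = 1 := by
  have := congrFun (congrFun hA.2.1 x) y
  rwa [Matrix.sum_apply, allOnes_apply] at this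

lemma scheme_partial (hA : IsAssociationScheme A) (s : Finset (Fin (d + 1))) (x y : X) :
    ∑ i ∈ s, A i x y ≤ 1 := by
  rw [← scheme_sum hA x y]
  exact Finset.sum_le_sum_of_subset_of_nonneg (Finset.subset_univ s)
    fun i _ _ => scheme_nonneg hA i x y

lemma scheme_disj (hA : IsAssociationScheme A) {i j : Fin (d + 1)} (hij : i ≠ j) (x y : X) :
    A i x y * A j x y = 0 := by
  have := scheme_partial hA {i, j} x y
  rw [Finset.sum_pair hij] at this
  rcases hA.2.2.2.1 i x y with h | h
  · simp [h]
  · rcases hA.2.2.2.1 j x y with h' | h'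
    · simp [h']
    · rw [h, h'] at this; norm_num at this

lemma scheme_trace (hA : IsAssociationScheme A) {i j : Fin (d + 1)} (hij : i ≠ j) :
    (A i * A j).trace = 0 := by
  simp only [Matrix.trace, Matrix.diag_apply, Matrix.mul_apply]
  refine Finset.sum_eq_zero fun x _ => Finset.sum_eq_zero fun y _ => ?_
  rw [(hA.2.2.1 j).apply x y]
  exact scheme_disj hA hij x y

/-- The Bose-Mesner algebra as a subspace. -/
def bm (A : Fin (d + 1) → Matrix X X ℝ) : Submodule ℝ (Matrix X X ℝ) :=
  Submodule.span ℝ (Set.range A)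

lemma mem_bm (A : Fin (d + 1) → Matrix X X ℝ) (i : Fin (d + 1)) : A i ∈ bm A :=
  Submodule.subset_span ⟨i, rfl⟩

lemma one_mem_bm (hA : IsAssociationScheme A) : (1 : Matrix X X ℝ) ∈ bm A := by
  rw [← hA.1]; exact mem_bm A 0

lemma J_mem_bm (hA : IsAssociationScheme A) : allOnes X ∈ bm A := by
  rw [← hA.2.1]; exact Submodule.sum_mem _ fun i _ => mem_bm A i

lemma projM_mem_bm (hA : IsAssociationScheme A) (i : Fin (d + 1)) (n t : ℝ) :
    projM (A i) n t ∈ bm A :=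
  Submodule.sub_mem _ (Submodule.add_mem _ (Submodule.smul_mem _ _ (mem_bm A i))
    (Submodule.smul_mem _ _ (one_mem_bm hA))) (Submodule.smul_mem _ _ (J_mem_bm hA))

lemma bm_symm (hA : IsAssociationScheme A) {M : Matrix X X ℝ} (hM : M ∈ bm A) : Mᵀ = M := by
  induction hM using Submodule.span_induction with
  | mem x h => obtain ⟨i, rfl⟩ := h; exact hA.2.2.1 i
  | zero => simp
  | add x y _ _ hx hy => simp [hx, hy]
  | smul c x _ hx => simp [hx]

lemma bm_mul (hA : IsAssociationScheme A) {M N : Matrix X X ℝ} (hM : M ∈ bm A)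
    (hN : N ∈ bm A) : M * N ∈ bm A := by
  have : bm A * bm A ≤ bm A := by
    rw [bm, Submodule.span_mul_span, Submodule.span_le]
    rintro _ ⟨_, ⟨i, rfl⟩, _, ⟨j, rfl⟩, rfl⟩
    obtain ⟨p, hp⟩ := hA.2.2.2.2 i j
    show A i * A j ∈ bm A
    rw [hp]
    exact Submodule.sum_mem _ fun h _ => Submodule.smul_mem _ _ (mem_bm A h)
  exact this (Submodule.mul_mem_mul hM hN)

lemma bm_comm (hA : IsAssociationScheme A) {M N : Matrix X X ℝ} (hM : M ∈ bm A)
    (hN : N ∈ bm A) : M * N = N * M := by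
  have := bm_symm hA (bm_mul hA hM hN)
  rw [Matrix.transpose_mul, bm_symm hA hM, bm_symm hA hN] at this
  exact this.symm

lemma proj_orth (hA : IsAssociationScheme A) {i j : Fin (d + 1)} (hij : i ≠ j) {n t t' : ℝ}
    (h : LatinLike (A i) n t) (h' : LatinLike (A j) n t') :
    projM (A i) n t * projM (A j) n t' = 0 := by
  refine mul_eq_zero_of_trace (projM_symm h) (projM_symm h') (projM_idem h) (projM_idem h')
    (bm_comm hA (projM_mem_bm hA i n t) (projM_mem_bm hA j n t')) ?_
  rw [projM_trace_mul h h' (scheme_trace hA hij), div_self h.hn]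
  ring

/-- If all non-trivial relations with one exception are of the same type, the scheme is
amorphic. -/
lemma amorphic_of_same (hA : IsAssociationScheme A) (b : Fin (d + 1)) (n : ℝ)
    (h : ∀ i, i ≠ 0 → i ≠ b → ∃ t, LatinLike (A i) n t) : IsAmorphic A := by
  intro d' f hf
  choose! t ht using h
  set F := fusedFamily A f with hF
  have hF0 : F 0 = 1 := by
    have : Finset.univ.filter (fun k => f k = 0) = {0} := by
      ext k; simp [hf.2 k]
    rw [hF, fusedFamily, this, Finset.sum_singleton, hA.1]
  have hFs : ∑ c, F c = allOnes X := by
    rw [← hA.2.1]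
    exact Finset.sum_fiberwise_of_maps_to (fun _ _ => Finset.mem_univ _) A
  refine ⟨hF0, hFs, ?_, ?_, ?_⟩
  · intro c
    refine bm_symm hA (Submodule.sum_mem _ fun i _ => mem_bm A i)
  · intro c x y
    have hle := scheme_partial hA (Finset.univ.filter (fun k => f k = c)) x y
    rw [hF, fusedFamily, Matrix.sum_apply]
    by_cases hz : ∀ k ∈ Finset.univ.filter (fun k => f k = c), A k x y = 0
    · left; exact Finset.sum_eq_zero hz
    · right
      push Not at hz
      obtain ⟨k, hk, hk0⟩ := hz
      have h1 : A k x y = 1 := (hA.2.2.2.1 k x y).resolve_left hk0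
      refine le_antisymm hle ?_
      rw [← h1]
      exact Finset.single_le_sum (f := fun i => A i x y)
        (fun i _ => scheme_nonneg hA i x y) hk
  · set V := Submodule.span ℝ (Set.range F) with hV
    have hFV : ∀ c, F c ∈ V := fun c => Submodule.subset_span ⟨c, rfl⟩
    have h1V : (1 : Matrix X X ℝ) ∈ V := hF0 ▸ hFV 0
    have hJV : allOnes X ∈ V := hFs ▸ Submodule.sum_mem _ fun c _ => hFV c
    let Q : Fin (d' + 1) → Matrix X X ℝ := fun c =>
      ∑ k ∈ Finset.univ.filter (fun k => f k = c), projM (A k) n (t k)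
    have hgood : ∀ c, c ≠ 0 → c ≠ f b → ∀ k, f k = c → LatinLike (A k) n (t k) := by
      intro c hc hcb k hk
      refine ht k ?_ ?_
      · rintro rfl; exact hc (hk ▸ (hf.2 0).2 rfl)
      · rintro rfl; exact hcb hk.symm
    have hQV : ∀ c, Q c ∈ V := by
      intro c
      have : Q c = n⁻¹ • F c + (∑ k ∈ Finset.univ.filter (fun k => f k = c), t k / n) •
          (1 : Matrix X X ℝ) - (∑ k ∈ Finset.univ.filter (fun k => f k = c), t k / n ^ 2) •
          allOnes X := by
        simp only [Q, projM, Finset.sum_sub_distrib, Finset.sum_add_distrib, Finset.sum_smul,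
          hF, fusedFamily, Finset.smul_sum]
      rw [this]
      exact Submodule.sub_mem _ (Submodule.add_mem _ (Submodule.smul_mem _ _ (hFV c))
        (Submodule.smul_mem _ _ h1V)) (Submodule.smul_mem _ _ hJV)
    have hQJ : ∀ c, c ≠ 0 → c ≠ f b → Q c * allOnes X = 0 := by
      intro c hc hcb
      rw [Finset.sum_mul]
      refine Finset.sum_eq_zero fun k hk => projM_mul_J (hgood c hc hcb k (by simpa using hk))
    have hJQ : ∀ c, c ≠ 0 → c ≠ f b → allOnes X * Q c = 0 := by
      intro c hc hcb
      rw [Finset.mul_sum]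
      refine Finset.sum_eq_zero fun k hk => J_mul_projM (hgood c hc hcb k (by simpa using hk))
    have hQQ : ∀ c e, c ≠ 0 → c ≠ f b → e ≠ 0 → e ≠ f b → Q c * Q e ∈ V := by
      intro c e hc hcb he heb
      have hsum : Q c * Q e = ∑ k ∈ Finset.univ.filter (fun k => f k = c),
          ∑ l ∈ Finset.univ.filter (fun k => f k = e),
            projM (A k) n (t k) * projM (A l) n (t l) := by
        simp only [Q, Finset.sum_mul_sum]
      by_cases hce : c = e
      · subst hce
        have : Q c * Q c = Q c := by
          rw [hsum]
          refine Finset.sum_congr rfl fun k hk => ?_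
          have hk' := hgood c hc hcb k (by simpa using hk)
          rw [Finset.sum_eq_single_of_mem k hk]
          · exact projM_idem hk'
          · intro l hl hlk
            exact proj_orth hA hlk.symm hk' (hgood c hc hcb l (by simpa using hl))
        rw [this]; exact hQV c
      · have : Q c * Q e = 0 := by
          rw [hsum]
          refine Finset.sum_eq_zero fun k hk => Finset.sum_eq_zero fun l hl => ?_
          have hk1 : f k = c := by simpa using hk
          have hl1 : f l = e := by simpa using hl
          refine proj_orth hA ?_ (hgood c hc hcb k hk1) (hgood e he heb l hl1)
          rintro rfl
          exact hce (hk1.symm.trans hl1)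
        rw [this]; exact Submodule.zero_mem _
    let S : Set (Matrix X X ℝ) := {M | M = 1 ∨ M = allOnes X ∨
      ∃ c, c ≠ 0 ∧ c ≠ f b ∧ M = Q c}
    have hSS : Submodule.span ℝ S * Submodule.span ℝ S ≤ V := by
      rw [Submodule.span_mul_span, Submodule.span_le]
      rintro _ ⟨M, hM, N, hN, rfl⟩
      show M * N ∈ V
      rcases hM with rfl | rfl | ⟨c, hc, hcb, rfl⟩ <;>
        rcases hN with rfl | rfl | ⟨e, he, heb, rfl⟩
      · simpa using h1V
      · simpa using hJV
      · simpa using hQV e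
      · simpa using hJV
      · rw [allOnes_mul_self]; exact Submodule.smul_mem _ _ hJV
      · rw [hJQ e he heb]; exact Submodule.zero_mem _
      · simpa using hQV c
      · rw [hQJ c hc hcb]; exact Submodule.zero_mem _
      · exact hQQ c e hc hcb he heb
    have h1S : (1 : Matrix X X ℝ) ∈ Submodule.span ℝ S := Submodule.subset_span (Or.inl rfl)
    have hJS : allOnes X ∈ Submodule.span ℝ S := Submodule.subset_span (Or.inr (Or.inl rfl))
    have hFS' : ∀ c, c ≠ f b → F c ∈ Submodule.span ℝ S := by
      intro c hcb
      by_cases hc : c = 0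
      · rw [hc, hF0]; exact h1S
      have : F c = n • Q c - (∑ k ∈ Finset.univ.filter (fun k => f k = c), t k) •
          (1 : Matrix X X ℝ) + (∑ k ∈ Finset.univ.filter (fun k => f k = c), t k / n) •
          allOnes X := by
        simp only [Q, Finset.sum_smul, Finset.smul_sum, ← Finset.sum_sub_distrib,
          ← Finset.sum_add_distrib, hF, fusedFamily]
        exact Finset.sum_congr rfl fun k hk => projM_inv (hgood c hc hcb k (by simpa using hk))
      rw [this]
      exact Submodule.add_mem _ (Submodule.sub_mem _ (Submodule.smul_mem _ _
        (Submodule.subset_span (Or.inr (Or.inr ⟨c, hc, hcb, rfl⟩))))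
        (Submodule.smul_mem _ _ h1S)) (Submodule.smul_mem _ _ hJS)
    have hFS : ∀ c, F c ∈ Submodule.span ℝ S := by
      intro c
      by_cases hcb : c = f b
      · have : F c = allOnes X - ∑ e ∈ Finset.univ.erase c, F e := by
          rw [← hFs, ← Finset.add_sum_erase _ _ (Finset.mem_univ c)]; abel
        rw [this]
        refine Submodule.sub_mem _ hJS (Submodule.sum_mem _ fun e he => hFS' e ?_)
        rw [← hcb]; exact (Finset.mem_erase.1 he).1
      · exact hFS' c hcb
    intro c e
    have := hSS (Submodule.mul_mem_mul (hFS c) (hFS e))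
    rw [hV, Submodule.mem_span_range_iff_exists_fun] at this
    obtain ⟨p, hp⟩ := this
    exact ⟨p, hp.symm⟩

lemma pattern_contra (hA : IsAssociationScheme A) (b : Fin (d + 1)) {P R Q Y : Matrix X X ℝ}
    (hP : P ∈ bm A) (hR : R ∈ bm A) (hQ : Q ∈ bm A)
    (hPP : P * P = P) (hQQ : Q * Q = Q) (hPR : P * R = 0) (hQY : Q * Y = 0)
    (hJP : allOnes X * P = 0) (hJR : allOnes X * R = 0)
    (n11 : P * Q ≠ 0) (n12 : P * Y ≠ 0) (n21 : R * Q ≠ 0) (n22 : R * Y ≠ 0)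
    (h : ∀ k, k ≠ 0 → k ≠ b → (∃ r s : ℝ, A k * P = r • P ∧ A k * R = s • R) ∨
      (∃ r s : ℝ, A k * Q = r • Q ∧ A k * Y = s • Y)) : False := by
  let D : Submodule ℝ (Matrix X X ℝ) :=
    { carrier := {w | ∃ r s u v : ℝ, w * (P * Q) = (r + u) • (P * Q) ∧
        w * (P * Y) = (r + v) • (P * Y) ∧ w * (R * Q) = (s + u) • (R * Q) ∧
        w * (R * Y) = (s + v) • (R * Y)}
      add_mem' := by
        rintro w w' ⟨r, s, u, v, h1, h2, h3, h4⟩ ⟨r', s', u', v', h1', h2', h3', h4'⟩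
        refine ⟨r + r', s + s', u + u', v + v', ?_, ?_, ?_, ?_⟩
        · rw [add_mul, h1, h1']; module
        · rw [add_mul, h2, h2']; module
        · rw [add_mul, h3, h3']; module
        · rw [add_mul, h4, h4']; module
      zero_mem' := ⟨0, 0, 0, 0, by simp, by simp, by simp, by simp⟩
      smul_mem' := by
        rintro c w ⟨r, s, u, v, h1, h2, h3, h4⟩
        refine ⟨c * r, c * s, c * u, c * v, ?_, ?_, ?_, ?_⟩
        · rw [smul_mul_assoc, h1]; module
        · rw [smul_mul_assoc, h2]; module
        · rw [smul_mul_assoc, h3]; module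
        · rw [smul_mul_assoc, h4]; module }
  have hJ : allOnes X ∈ D := by
    refine ⟨0, 0, 0, 0, ?_, ?_, ?_, ?_⟩ <;> simp [← mul_assoc, hJP, hJR]
  have h1 : A 0 ∈ D := by
    rw [hA.1]
    refine ⟨1, 1, 0, 0, ?_, ?_, ?_, ?_⟩ <;> simp
  have hk' : ∀ k, k ≠ b → A k ∈ D := by
    intro k hkb
    by_cases hk0 : k = 0
    · rw [hk0]; exact h1
    rcases h k hk0 hkb with ⟨r, s, h1, h2⟩ | ⟨r, s, h1, h2⟩
    · refine ⟨r, s, 0, 0, ?_, ?_, ?_, ?_⟩ <;> simp [← mul_assoc, h1, h2]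
    · have c1 := bm_comm hA (mem_bm A k) hP
      have c2 := bm_comm hA (mem_bm A k) hR
      refine ⟨0, 0, r, s, ?_, ?_, ?_, ?_⟩ <;> simp [← mul_assoc, c1, c2] <;>
        simp [mul_assoc, h1, h2]
  have hk : ∀ k, A k ∈ D := by
    intro k
    by_cases hkb : k = b
    · have : A k = allOnes X - ∑ e ∈ Finset.univ.erase k, A e := by
        rw [← hA.2.1, ← Finset.add_sum_erase _ _ (Finset.mem_univ k)]; abel
      rw [this]
      refine Submodule.sub_mem _ hJ (Submodule.sum_mem _ fun e he => hk' e ?_)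
      rw [← hkb]; exact (Finset.mem_erase.1 he).1
    · exact hk' k hkb
  have hD : bm A ≤ D := Submodule.span_le.2 (by rintro _ ⟨k, rfl⟩; exact hk k)
  obtain ⟨r, s, u, v, e1, e2, e3, e4⟩ := hD (bm_mul hA hP hQ)
  have cPQ := bm_comm hA hP hQ
  have cRQ := bm_comm hA hR hQ
  have f1 : P * Q * (P * Q) = P * Q := by
    rw [mul_assoc, ← mul_assoc Q P Q, ← cPQ, mul_assoc P Q Q, hQQ, ← mul_assoc, hPP]
  have f2 : P * Q * (P * Y) = 0 := by
    rw [cPQ, mul_assoc, ← mul_assoc P P Y, hPP, ← mul_assoc, ← cPQ, mul_assoc, hQY, mul_zero]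
  have f3 : ∀ Z, P * Q * (R * Z) = 0 := by
    intro Z
    rw [mul_assoc, ← mul_assoc Q R Z, ← cRQ, ← mul_assoc, ← mul_assoc, hPR, zero_mul, zero_mul]
  rw [f1] at e1
  rw [f2] at e2
  rw [f3] at e3 e4
  have g1 : r + u = 1 := by
    have : (r + u - 1) • (P * Q) = 0 := by rw [sub_smul, ← e1]; simp
    have := (smul_eq_zero.1 this).resolve_right n11
    linarith
  have g2 := (smul_eq_zero.1 e2.symm).resolve_right n12
  have g3 := (smul_eq_zero.1 e3.symm).resolve_right n21
  have g4 := (smul_eq_zero.1 e4.symm).resolve_right n22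
  linarith

lemma A_mul_of_projM {B Z : Matrix X X ℝ} {n t r : ℝ} (h : LatinLike B n t)
    (hJ : allOnes X * Z = 0) (hr : projM B n t * Z = r • Z) : B * Z = (n * r - t) • Z := by
  conv_lhs => rw [projM_inv h]
  rw [add_mul, sub_mul, smul_mul_assoc, smul_mul_assoc, smul_mul_assoc, hJ, hr, one_mul]
  module

/-- Second row (or column) for the pattern. -/
lemma exists_second (hA : IsAssociationScheme A) (S : Set (Fin (d + 1))) (n : ℝ)
    (t : Fin (d + 1) → ℝ) (hS : ∀ k ∈ S, LatinLike (A k) n (t k)) (i : Fin (d + 1))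
    (hi : i ∈ S) :
    ∃ R ∈ bm A, projM (A i) n (t i) * R = 0 ∧ allOnes X * R = 0 ∧
      (∀ k ∈ S, ∃ r s : ℝ, A k * projM (A i) n (t i) = r • projM (A i) n (t i) ∧
        A k * R = s • R) ∧
      ((∃ j ∈ S, R = projM (A j) n (t j)) ∨
        R = 1 - (n ^ 2)⁻¹ • allOnes X - projM (A i) n (t i)) := by
  have hi' := hS i hi
  have hn := hi'.hn
  have base : ∀ j ∈ S, ∀ k ∈ S, ∃ r : ℝ,
      A k * projM (A j) n (t j) = r • projM (A j) n (t j) := by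
    intro j hj k hk
    by_cases hkj : k = j
    · subst hkj
      exact ⟨_, A_mul_of_projM (r := 1) (hS k hk) (J_mul_projM (hS k hk))
        (by rw [projM_idem (hS k hk), one_smul])⟩
    · exact ⟨_, A_mul_of_projM (r := 0) (hS k hk) (J_mul_projM (hS j hj))
        (by rw [proj_orth hA hkj (hS k hk) (hS j hj), zero_smul])⟩
  by_cases hex : ∃ j ∈ S, j ≠ i
  · obtain ⟨j, hj, hji⟩ := hex
    refine ⟨projM (A j) n (t j), projM_mem_bm hA _ _ _, proj_orth hA hji.symm hi' (hS j hj),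
      J_mul_projM (hS j hj), ?_, Or.inl ⟨j, hj, rfl⟩⟩
    intro k hk
    obtain ⟨r, hr⟩ := base i hi k hk
    obtain ⟨s, hs⟩ := base j hj k hk
    exact ⟨r, s, hr, hs⟩
  · push Not at hex
    have hJ : allOnes X * (1 - (n ^ 2)⁻¹ • allOnes X - projM (A i) n (t i)) = 0 := by
      rw [mul_sub, mul_sub, J_mul_projM hi', mul_smul_comm, allOnes_mul_self, hi'.card,
        smul_smul, inv_mul_cancel₀ (pow_ne_zero 2 hn)]
      simp
    have h0 : projM (A i) n (t i) * (1 - (n ^ 2)⁻¹ • allOnes X - projM (A i) n (t i)) = 0 := by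
      rw [mul_sub, mul_sub, projM_idem hi', mul_smul_comm, projM_mul_J hi']
      simp
    refine ⟨_, ?_, h0, hJ, ?_, Or.inr rfl⟩
    · exact Submodule.sub_mem _ (Submodule.sub_mem _ (one_mem_bm hA)
        (Submodule.smul_mem _ _ (J_mem_bm hA))) (projM_mem_bm hA _ _ _)
    · intro k hk
      obtain rfl := hex k hk
      obtain ⟨r, hr⟩ := base k hk k hk
      exact ⟨r, _, hr, A_mul_of_projM (r := 0) hi' hJ (by rw [h0, zero_smul])⟩

lemma valency_le (hA : IsAssociationScheme A) {i j : Fin (d + 1)} (hi : i ≠ 0) (hj : j ≠ 0)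
    (hij : i ≠ j) {n t n' t' : ℝ} (h : LatinLike (A i) n t) (h' : LatinLike (A j) n' t') :
    1 + t * (n - 1) + t' * (n' - 1) ≤ n ^ 2 := by
  have hne : Nonempty X := by
    by_contra hc
    rw [not_nonempty_iff] at hc
    have := h.card
    simp at this
    exact h.hn (pow_eq_zero_iff (two_ne_zero) |>.1 this.symm)
  obtain ⟨x⟩ := hne
  have row : ∀ {k n t}, LatinLike (A k) n t → ∑ y, A k x y = t * (n - 1) := by
    intro k n t hk
    have := congrFun (congrFun hk.row x) x
    simpa [Matrix.mul_apply, allOnes_apply] using this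
  have row0 : ∑ y, A 0 x y = 1 := by
    rw [hA.1]; simp [Matrix.one_apply]
  rw [← h.card, ← row h, ← row h', ← row0, ← Finset.sum_add_distrib, ← Finset.sum_add_distrib]
  calc _ ≤ ∑ y : X, (1 : ℝ) := by
        refine Finset.sum_le_sum fun y _ => ?_
        have := scheme_partial hA {0, i, j} x y
        rw [Finset.sum_insert (by simp [hi.symm, hj.symm]), Finset.sum_pair hij] at this
        linarith
    _ = _ := by simp

lemma ne_zero_of_trace {M : Matrix X X ℝ} (h : M.trace ≠ 0) : M ≠ 0 := by
  rintro rfl; simp at h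

/-- Mixed types cannot occur, unless all relations on one side are conference graphs. -/
lemma mixed_contra (hA : IsAssociationScheme A) (b : Fin (d + 1)) (n : ℝ)
    (S T : Set (Fin (d + 1))) (hST : ∀ k, k ≠ 0 → k ≠ b → k ∈ S ∨ k ∈ T)
    (hdis : ∀ i ∈ S, ∀ j ∈ T, i ≠ j)
    (t u : Fin (d + 1) → ℝ) (hS : ∀ k ∈ S, LatinLike (A k) n (t k))
    (hT : ∀ k ∈ T, LatinLike (A k) (-n) (u k)) {i j : Fin (d + 1)} (hi : i ∈ S) (hj : j ∈ T)
    (hi0 : i ≠ 0) (hj0 : j ≠ 0)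
    (hni : n ≠ 2 * t i - 1) (hnj : -n ≠ 2 * u j - 1) : False := by
  obtain ⟨R, hR, hPR, hJR, hRS, hR'⟩ := exists_second hA S n t hS i hi
  obtain ⟨Y, hY, hQY, hJY, hYT, hY'⟩ := exists_second hA T (-n) u hT j hj
  have hn := (hS i hi).hn
  have tr1 : ∀ k ∈ S, ∀ l ∈ T,
      (projM (A k) n (t k) * projM (A l) (-n) (u l)).trace = -2 * t k * u l := by
    intro k hk l hl
    rw [projM_trace_mul (hS k hk) (hT l hl) (scheme_trace hA (hdis k hk l hl)),
      div_neg, div_self hn]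
    ring
  have nz : ∀ k ∈ S, ∀ l ∈ T, -2 * t k * u l ≠ 0 := by
    intro k hk l hl
    exact mul_ne_zero (mul_ne_zero (by norm_num) (hS k hk).ht) (hT l hl).ht
  have n1Y : ∀ k ∈ S, projM (A k) n (t k) * Y ≠ 0 := by
    intro k hk
    apply ne_zero_of_trace
    rcases hY' with ⟨l, hl, rfl⟩ | rfl
    · rw [tr1 k hk l hl]; exact nz k hk l hl
    · rw [mul_sub, mul_sub, mul_smul_comm, projM_mul_J (hS k hk), smul_zero, sub_zero, mul_one,
        Matrix.trace_sub, tr1 k hk j hj, projM_trace (hS k hk)]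
      have : t k * (n - 1) - -2 * t k * u j = t k * (n + 2 * u j - 1) := by ring
      rw [this]
      refine mul_ne_zero (hS k hk).ht fun h => hnj ?_
      linarith
  have nRQ : ∀ l ∈ T, R * projM (A l) (-n) (u l) ≠ 0 := by
    intro l hl
    apply ne_zero_of_trace
    rcases hR' with ⟨k, hk, rfl⟩ | rfl
    · rw [tr1 k hk l hl]; exact nz k hk l hl
    · rw [sub_mul, sub_mul, smul_mul_assoc, J_mul_projM (hT l hl), smul_zero, sub_zero, one_mul,
        Matrix.trace_sub, tr1 i hi l hl, projM_trace (hT l hl)]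
      have : u l * (-n - 1) - -2 * t i * u l = u l * (-n + 2 * t i - 1) := by ring
      rw [this]
      refine mul_ne_zero (hT l hl).ht fun h => hni ?_
      linarith
  have n22 : R * Y ≠ 0 := by
    rcases hR' with ⟨k, hk, rfl⟩ | rfl
    · exact n1Y k hk
    rcases hY' with ⟨l, hl, rfl⟩ | rfl
    · exact nRQ l hl
    apply ne_zero_of_trace
    rw [sub_mul, sub_mul, smul_mul_assoc, hJY, smul_zero, sub_zero, one_mul]
    simp only [mul_sub, mul_smul_comm, projM_mul_J (hS i hi), smul_zero, sub_zero, mul_one,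
      Matrix.trace_sub, Matrix.trace_smul, tr1 i hi j hj, projM_trace (hS i hi),
      projM_trace (hT j hj), Matrix.trace_one, trace_allOnes, (hS i hi).card, smul_eq_mul]
    have hv := valency_le hA hi0 hj0 (hdis i hi j hj) (hS i hi) (hT j hj)
    have e : ((-n) ^ 2)⁻¹ * n ^ 2 = 1 := by
      rw [neg_sq]; exact inv_mul_cancel₀ (pow_ne_zero 2 hn)
    rw [e]
    have p1 := (hS i hi).pos
    have p2 := (hT j hj).pos
    have p3 : t i * u j < 0 := by
      have h3 := mul_pos p1 p2
      have h4 : t i * n * (u j * -n) = - (t i * u j) * n ^ 2 := by ring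
      rw [h4] at h3
      have := pos_of_mul_pos_left h3 (sq_nonneg n)
      linarith
    nlinarith
  refine pattern_contra hA b (projM_mem_bm hA i n (t i)) hR (projM_mem_bm hA j (-n) (u j))
    (projM_idem (hS i hi)) (projM_idem (hT j hj)) hPR hQY (J_mul_projM (hS i hi)) hJR
    (ne_zero_of_trace (by rw [tr1 i hi j hj]; exact nz i hi j hj)) (n1Y i hi) (nRQ j hj) n22 ?_
  intro k hk0 hkb
  rcases hST k hk0 hkb with hk | hk
  · exact Or.inl (hRS k hk)
  · exact Or.inr (hYT k hk)

end Scheme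

end Proof
/-- If at most one relation of an association scheme is neither strongly
regular of Latin square type nor strongly regular of negative Latin square type, then the
scheme is amorphic. -/
theorem atMostOne_nonLatin_isAmorphic
    {X : Type*} [Fintype X] [DecidableEq X] {d : ℕ}
    (A : Fin (d + 1) → Matrix X X ℝ) (hA : IsAssociationScheme A)
    (h1 : {i : Fin (d + 1) | i ≠ 0 ∧
      ¬(IsLSTypeSRG (A i) ∨ IsNLSTypeSRG (A i))}.ncard ≤ 1) :
    IsAmorphic A := by
  classical
  obtain ⟨b, hb⟩ : ∃ b : Fin (d + 1), ∀ i, i ≠ 0 → i ≠ b →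
      IsLSTypeSRG (A i) ∨ IsNLSTypeSRG (A i) := by
    rw [Set.ncard_le_one (Set.toFinite _)] at h1
    by_cases hex : ∃ b : Fin (d + 1), b ≠ 0 ∧ ¬(IsLSTypeSRG (A b) ∨ IsNLSTypeSRG (A b))
    · obtain ⟨b, hb⟩ := hex
      refine ⟨b, fun i hi hib => ?_⟩
      by_contra hc
      exact hib (h1 i ⟨hi, hc⟩ b hb)
    · push Not at hex
      refine ⟨0, fun i hi _ => ?_⟩
      by_contra hc
      exact hc (hex i hi)
  set m : ℝ := Real.sqrt (Fintype.card X) with hm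
  have hcl : ∀ i, i ≠ 0 → i ≠ b →
      (∃ t, LatinLike (A i) m t) ∨ (∃ t, LatinLike (A i) (-m) t) := by
    intro i hi hib
    rcases hb i hi hib with ⟨v, k, l, μ, hs, n, t, hn, ht, hv, hk, e1, e2⟩ |
      ⟨v, k, l, μ, hs, n, t, hn, ht, hv, hk, e1, e2⟩
    · left
      have h := latinLike_of_srg hs (mul_pos ht hn) hv hk e1 e2
      have : m = n := by
        rw [hm, h.card]; exact Real.sqrt_sq (by exact_mod_cast hn.le)
      rw [this]; exact ⟨t, h⟩
    · right
      have h := latinLike_of_srg hs (mul_pos_of_neg_of_neg ht hn) hv hk e1 e2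
      have : m = -n := by
        rw [hm, h.card, ← neg_sq]; exact Real.sqrt_sq (by
          have : (n : ℝ) < 0 := by exact_mod_cast hn
          linarith)
      rw [this, neg_neg]; exact ⟨t, h⟩
  by_cases hL : ∀ i, i ≠ 0 → i ≠ b → ∃ t, LatinLike (A i) m t
  · exact amorphic_of_same hA b m hL
  by_cases hN : ∀ i, i ≠ 0 → i ≠ b → ∃ t, LatinLike (A i) (-m) t
  · exact amorphic_of_same hA b (-m) hN
  exfalso
  push Not at hL hN
  obtain ⟨j, hj0, hjb, hj⟩ := hL
  obtain ⟨i, hi0, hib, hi⟩ := hN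
  let S : Set (Fin (d + 1)) := {k | k ≠ 0 ∧ k ≠ b ∧ ∃ t, LatinLike (A k) m t}
  let T : Set (Fin (d + 1)) := {k | k ≠ 0 ∧ k ≠ b ∧ ¬ ∃ t, LatinLike (A k) m t}
  have hS : ∀ k ∈ S, ∃ t, LatinLike (A k) m t := fun k hk => hk.2.2
  have hT : ∀ k ∈ T, ∃ t, LatinLike (A k) (-m) t := fun k hk =>
    (hcl k hk.1 hk.2.1).resolve_left hk.2.2
  choose! t ht using hS
  choose! u hu using hT
  have hiS : i ∈ S := ⟨hi0, hib, (hcl i hi0 hib).resolve_right (by push Not; exact hi)⟩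
  have hjT : j ∈ T := ⟨hj0, hjb, by push Not; exact hj⟩
  refine mixed_contra hA b m S T ?_ ?_ t u ht hu hiS hjT hi0 hj0 ?_ ?_
  · intro k hk0 hkb
    by_cases h : ∃ t, LatinLike (A k) m t
    · exact Or.inl ⟨hk0, hkb, h⟩
    · exact Or.inr ⟨hk0, hkb, h⟩
  · rintro k hk l hl rfl
    exact hl.2.2 hk.2.2
  · intro h
    exact hi _ ((ht i hiS).switch h)
  · intro h
    have := (hu j hjT).switch h
    rw [neg_neg] at this
    exact hj _ this
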